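/- Let P : ℝ^n → ℝ be convex and differentiable with ∇P Lipschitz continuous with constant h > 0. Decompose ℝ^n = ℝ^{n_1} × ⋯ × ℝ^{n_N}; for each i = 1,…,N let q_i : ℝ^{n_i} → (−∞, +∞] be proper, lower semicontinuous, and convex, let c_i > 0, and set Q(λ) = Σ_{i=1}^N q_i(λ_i) and Ψ = P + Q. Let D ∈ ℕ and τ : ℕ → ℕ satisfy 0 ≤ k − τ(k) ≤ D for all k. Let {λ(k)}_{k∈ℕ} be generated blockwise by λ_i(k+1) = prox^{c_i}_{q_i}[ λ_i(k) − c_i ∇_{λ_i} P(λ(τ(k))) ], and let λ* ∈ ℝ^n be a minimizer of Ψ. Then for every K ∈ ℕ, Σ_{k=0}^{K} ( Ψ(λ(k+1)) − Ψ(λ*) ) ≤ Σ_{k=0}^{K} Σ_{i=1}^N ( h(D+1)²/2 − 1/(2c_i) ) ‖λ_i(k+1) − λ_i(k)‖² + Σ_{i=1}^N (1/(2c_i)) ‖λ_i(0) − λ*_i‖². -/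

import Mathlib

open scoped RealInnerProductSpace
open Finset

noncomputable section

/-- A proper extended-real-valued function: never `⊥` and not identically `⊤`. -/
def ProperE {E : Type*} (f : E → EReal) : Prop :=
  (∀ x, f x ≠ ⊥) ∧ (∃ x, f x ≠ ⊤)

/-- Convexity for extended-real-valued functions. -/
def ERealConvexOn {E : Type*} [AddCommGroup E] [Module ℝ E] (f : E → EReal) : Prop :=
  ∀ x y : E, ∀ a b : ℝ, 0 ≤ a → 0 ≤ b → a + b = 1 →
    f (a • x + b • y) ≤ (a : EReal) * f x + (b : EReal) * f y

/-- The block decomposition `ℝ^n = ℝ^{n_1} × ⋯ × ℝ^{n_N}` with the Euclidean norm. -/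
abbrev Blk {N : ℕ} (dims : Fin N → ℕ) :=
  PiLp 2 (fun i : Fin N => EuclideanSpace ℝ (Fin (dims i)))

section Smooth

variable {E : Type*} [NormedAddCommGroup E] [InnerProductSpace ℝ E] [CompleteSpace E]

lemma HasGradientAt.hasDerivAt_line {f : E → ℝ} {g x d : E} {t : ℝ}
    (hf : HasGradientAt f g (x + t • d)) :
    HasDerivAt (fun s : ℝ => f (x + s • d)) ⟪g, d⟫ t := by
  have hline : HasDerivAt (fun s : ℝ => x + s • d) d t := by
    simpa using ((hasDerivAt_id t).smul_const d).const_add x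
  exact (hf.hasFDerivAt.comp_hasDerivAt t hline).congr_deriv (by simp)

lemma ConvexOn.add_inner_gradient_le {f : E → ℝ} {g x : E} (hf : ConvexOn ℝ Set.univ f)
    (hg : HasGradientAt f g x) (y : E) : f x + ⟪g, y - x⟫ ≤ f y := by
  have hd : HasDerivAt (fun s : ℝ => f (x + s • (y - x))) ⟪g, y - x⟫ 0 :=
    HasGradientAt.hasDerivAt_line (by simpa using hg)
  have hconv : ConvexOn ℝ Set.univ (fun s : ℝ => f (x + s • (y - x))) := by
    have := hf.comp_affineMap (AffineMap.lineMap x y : ℝ →ᵃ[ℝ] E)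
    simpa [Function.comp_def, AffineMap.lineMap_apply, add_comm] using this
  have := hconv.le_slope_of_hasDerivAt (Set.mem_univ 0) (Set.mem_univ 1) one_pos hd
  simp [slope_def_field] at this
  linarith

lemma le_add_inner_gradient_add_sq {f : E → ℝ} {g : E → E} {h : ℝ}
    (hg : ∀ x, HasGradientAt f (g x) x) (hLip : ∀ u v, ‖g u - g v‖ ≤ h * ‖u - v‖) (x y : E) :
    f y ≤ f x + ⟪g x, y - x⟫ + h / 2 * ‖y - x‖ ^ 2 := by
  set d := y - x with hd
  have hderiv (t : ℝ) : HasDerivAt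
      (fun s : ℝ => f (x + s • d) - s * ⟪g x, d⟫ - h / 2 * ‖d‖ ^ 2 * s ^ 2)
      (⟪g (x + t • d), d⟫ - ⟪g x, d⟫ - h * ‖d‖ ^ 2 * t) t := by
    have h1 := (hg (x + t • d)).hasDerivAt_line
    have h2 := (hasDerivAt_id t).mul_const ⟪g x, d⟫
    have h3 := ((hasDerivAt_id t).pow 2).const_mul (h / 2 * ‖d‖ ^ 2)
    refine ((h1.sub h2).sub h3).congr_deriv ?_
    simp
    ring
  have hanti : AntitoneOn
      (fun s : ℝ => f (x + s • d) - s * ⟪g x, d⟫ - h / 2 * ‖d‖ ^ 2 * s ^ 2) (Set.Icc 0 1) := by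
    refine antitoneOn_of_deriv_nonpos (convex_Icc 0 1)
      (fun t _ => (hderiv t).continuousAt.continuousWithinAt)
      (fun t _ => (hderiv t).differentiableAt.differentiableWithinAt) fun t ht => ?_
    rw [(hderiv t).deriv]
    rw [interior_Icc] at ht
    have h1 : ⟪g (x + t • d) - g x, d⟫ ≤ h * ‖d‖ ^ 2 * t := by
      calc ⟪g (x + t • d) - g x, d⟫ ≤ ‖g (x + t • d) - g x‖ * ‖d‖ := real_inner_le_norm _ _
        _ ≤ h * ‖x + t • d - x‖ * ‖d‖ := by gcongr; exact hLip _ _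
        _ = h * ‖d‖ ^ 2 * t := by
          rw [add_sub_cancel_left, norm_smul, Real.norm_of_nonneg ht.1.le]
          ring
    rw [inner_sub_left] at h1
    linarith
  have := hanti (Set.left_mem_Icc.2 zero_le_one) (Set.right_mem_Icc.2 zero_le_one) zero_le_one
  simp [hd] at this
  simp only [hd]
  linarith

end Smooth

/-- The variational inequality satisfied by a proximal point `p` of `f` at `w`. -/
lemma prox_sub_le_inner {E : Type*} [NormedAddCommGroup E] [InnerProductSpace ℝ E]
    {f : E → EReal} (hf : ERealConvexOn f) {c : ℝ} {p w y : E} {r s : ℝ}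
    (hp : f p = r) (hy : f y = s)
    (hprox : ∀ v, f p + ((1 / (2 * c) * ‖p - w‖ ^ 2 : ℝ) : EReal)
      ≤ f v + ((1 / (2 * c) * ‖v - w‖ ^ 2 : ℝ) : EReal)) :
    r - s ≤ 1 / c * ⟪p - w, y - p⟫ := by
  have key (t : ℝ) (ht : t ∈ Set.Ioo (0 : ℝ) 1) :
      r - s ≤ 1 / c * ⟪p - w, y - p⟫ + t * (1 / (2 * c) * ‖y - p‖ ^ 2) := by
    have h1 := hf p y (1 - t) t (by linarith [ht.2]) ht.1.le (by ring)
    have h2 := (hprox ((1 - t) • p + t • y)).trans (add_le_add_left h1 _)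
    rw [hp, hy] at h2
    have h3 : r + 1 / (2 * c) * ‖p - w‖ ^ 2 ≤
        (1 - t) * r + t * s + 1 / (2 * c) * ‖(1 - t) • p + t • y - w‖ ^ 2 := by
      exact_mod_cast h2
    have h4 : (1 - t) • p + t • y - w = (p - w) + t • (y - p) := by module
    rw [h4, norm_add_sq_real, inner_smul_right, norm_smul, Real.norm_of_nonneg ht.1.le] at h3
    refine le_of_mul_le_mul_left ?_ ht.1
    have h5 : 1 / c = 2 * (1 / (2 * c)) := by
      rw [one_div, one_div, mul_inv]
      ring
    rw [h5]
    linarith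
  have hlim : Filter.Tendsto
      (fun t : ℝ => 1 / c * ⟪p - w, y - p⟫ + t * (1 / (2 * c) * ‖y - p‖ ^ 2))
      (nhdsWithin 0 (Set.Ioi 0)) (nhds (1 / c * ⟪p - w, y - p⟫)) := by
    refine tendsto_nhdsWithin_of_tendsto_nhds ?_
    have : Continuous
        (fun t : ℝ => 1 / c * ⟪p - w, y - p⟫ + t * (1 / (2 * c) * ‖y - p‖ ^ 2)) := by fun_prop
    simpa using this.tendsto 0
  exact ge_of_tendsto hlim
    (Filter.eventually_of_mem (Ioo_mem_nhdsGT zero_lt_one) key)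

/-- The three-point form of `prox_sub_le_inner` for a forward-backward step from `x` along `g`. -/
lemma prox_step_sub_le {E : Type*} [NormedAddCommGroup E] [InnerProductSpace ℝ E]
    {f : E → EReal} (hf : ERealConvexOn f) {c : ℝ} (hc : 0 < c) {p x g y : E} {r s : ℝ}
    (hp : f p = r) (hy : f y = s)
    (hprox : ∀ v, f p + ((1 / (2 * c) * ‖p - (x - c • g)‖ ^ 2 : ℝ) : EReal)
      ≤ f v + ((1 / (2 * c) * ‖v - (x - c • g)‖ ^ 2 : ℝ) : EReal)) :
    r - s ≤ -⟪g, p - y⟫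
      + 1 / (2 * c) * (‖x - y‖ ^ 2 - ‖p - x‖ ^ 2 - ‖p - y‖ ^ 2) := by
  refine (prox_sub_le_inner hf hp hy hprox).trans_eq ?_
  have h1 : x - y = -((p - x) + (y - p)) := by abel
  have h2 : p - y = -(y - p) := by abel
  have h3 : p - (x - c • g) = (p - x) + c • g := by abel
  rw [h1, h2, h3, norm_neg, norm_neg, norm_add_sq_real, inner_add_left, inner_smul_left,
    inner_neg_right]
  simp only [conj_trivial]
  field_simp
  ring

lemma norm_sub_sq_le_mul_sum_Ico {E : Type*} [SeminormedAddCommGroup E] (a : ℕ → E)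
    {m n D : ℕ} (hmn : m ≤ n) (hD : n - m ≤ D) :
    ‖a n - a m‖ ^ 2 ≤ D * ∑ j ∈ Ico m n, ‖a (j + 1) - a j‖ ^ 2 := by
  have h1 : ‖a n - a m‖ ≤ ∑ j ∈ Ico m n, ‖a (j + 1) - a j‖ := by
    rw [← Finset.sum_Ico_sub a hmn]
    exact norm_sum_le _ _
  calc ‖a n - a m‖ ^ 2 ≤ (∑ j ∈ Ico m n, ‖a (j + 1) - a j‖) ^ 2 := by gcongr
    _ ≤ #(Ico m n) * ∑ j ∈ Ico m n, ‖a (j + 1) - a j‖ ^ 2 := sq_sum_le_card_mul_sum_sq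
    _ ≤ D * ∑ j ∈ Ico m n, ‖a (j + 1) - a j‖ ^ 2 := by
      gcongr
      simpa using hD

/-- Windows of length at most `D + 1` ending at `k` cover each index at most `D + 1` times. -/
lemma sum_sum_window_le {d : ℕ → ℝ} (hd : ∀ j, 0 ≤ d j) {D : ℕ} {τ : ℕ → ℕ}
    (hτ : ∀ k, k - τ k ≤ D) (K : ℕ) :
    ∑ k ∈ range K, ∑ j ∈ Ico (τ k) (k + 1), d j ≤ (D + 1) * ∑ j ∈ range K, d j := by
  rw [Finset.sum_comm' (t' := range K)
    (s' := fun j => {k ∈ range K | τ k ≤ j ∧ j ≤ k}) (by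
      intro k j
      simp only [Finset.mem_range, Finset.mem_Ico, Finset.mem_filter]
      omega), Finset.mul_sum]
  gcongr with j hj
  rw [Finset.sum_const, nsmul_eq_mul]
  refine mul_le_mul_of_nonneg_right ?_ (hd j)
  have hsub : {k ∈ range K | τ k ≤ j ∧ j ≤ k} ⊆ Icc j (j + D) := by
    intro k hk
    have := hτ k
    simp only [Finset.mem_filter, Finset.mem_Icc] at hk ⊢
    omega
  have := Finset.card_le_card hsub
  rw [Nat.card_Icc] at this
  exact_mod_cast this.trans (by omega)

lemma sum_norm_delay_sq_le {E : Type*} [SeminormedAddCommGroup E] (a : ℕ → E) {D : ℕ}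
    {τ : ℕ → ℕ} (hτ : ∀ k, τ k ≤ k ∧ k - τ k ≤ D) (K : ℕ) :
    ∑ k ∈ range K, ‖a (k + 1) - a (τ k)‖ ^ 2
      ≤ ((D : ℝ) + 1) ^ 2 * ∑ k ∈ range K, ‖a (k + 1) - a k‖ ^ 2 := by
  calc ∑ k ∈ range K, ‖a (k + 1) - a (τ k)‖ ^ 2
      ≤ ∑ k ∈ range K, ((D : ℝ) + 1) * ∑ j ∈ Ico (τ k) (k + 1), ‖a (j + 1) - a j‖ ^ 2 := by
        gcongr with k
        have := hτ k
        exact_mod_cast norm_sub_sq_le_mul_sum_Ico a (m := τ k) (n := k + 1) (D := D + 1)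
          (by omega) (by omega)
    _ = ((D : ℝ) + 1) * ∑ k ∈ range K, ∑ j ∈ Ico (τ k) (k + 1), ‖a (j + 1) - a j‖ ^ 2 := by
        rw [Finset.mul_sum]
    _ ≤ ((D : ℝ) + 1) * ((D + 1) * ∑ k ∈ range K, ‖a (k + 1) - a k‖ ^ 2) := by
        gcongr
        exact sum_sum_window_le (d := fun j => ‖a (j + 1) - a j‖ ^ 2)
          (fun j => by positivity) (fun k => (hτ k).2) K
    _ = _ := by ring

lemma EReal.coe_sum_real {ι : Type*} (s : Finset ι) (f : ι → ℝ) :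
    ((∑ i ∈ s, f i : ℝ) : EReal) = ∑ i ∈ s, (f i : EReal) :=
  map_sum (⟨⟨Real.toEReal, EReal.coe_zero⟩, EReal.coe_add⟩ : ℝ →+ EReal) f s

lemma EReal.sum_ne_bot {ι : Type*} {s : Finset ι} {f : ι → EReal}
    (hf : ∀ i ∈ s, f i ≠ ⊥) : ∑ i ∈ s, f i ≠ ⊥ :=
  Finset.sum_induction f (· ≠ ⊥) (fun _ _ ha hb => EReal.add_ne_bot_iff.2 ⟨ha, hb⟩) (by simp) hf

lemma EReal.ne_top_of_sum_ne_top {ι : Type*} {s : Finset ι} {f : ι → EReal}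
    (hbot : ∀ i ∈ s, f i ≠ ⊥) (hsum : ∑ i ∈ s, f i ≠ ⊤) {i : ι} (hi : i ∈ s) : f i ≠ ⊤ := by
  classical
  rw [← Finset.add_sum_erase s f hi] at hsum
  intro h
  rw [h] at hsum
  exact hsum (EReal.top_add_of_ne_bot
    (EReal.sum_ne_bot fun j hj => hbot j (Finset.mem_of_mem_erase hj)))

/-- One step of the delayed forward-backward iteration, with the gradient taken at the delayed
point `z`. -/
lemma delayed_step_le {N : ℕ} {dims : Fin N → ℕ} {h : ℝ} {P : Blk dims → ℝ}
    {gradP : Blk dims → Blk dims} (hPconv : ConvexOn ℝ Set.univ P)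
    (hPdiff : ∀ x, HasGradientAt P (gradP x) x)
    (hLip : ∀ u v : Blk dims, ‖gradP u - gradP v‖ ≤ h * ‖u - v‖)
    {x p y z : Blk dims} {r s c : Fin N → ℝ}
    (hq : ∀ i, r i - s i ≤ -⟪gradP z i, p i - y i⟫
      + 1 / (2 * c i) * (‖x i - y i‖ ^ 2 - ‖p i - x i‖ ^ 2 - ‖p i - y i‖ ^ 2)) :
    (P p + ∑ i, r i) - (P y + ∑ i, s i) ≤ h / 2 * ‖p - z‖ ^ 2
      + ∑ i, 1 / (2 * c i) * (‖x i - y i‖ ^ 2 - ‖p i - x i‖ ^ 2 - ‖p i - y i‖ ^ 2) := by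
  have h1 := le_add_inner_gradient_add_sq hPdiff hLip z p
  have h2 := hPconv.add_inner_gradient_le (hPdiff z) y
  have h3 := Finset.sum_le_sum fun i (_ : i ∈ univ) => hq i
  rw [Finset.sum_sub_distrib, Finset.sum_add_distrib, Finset.sum_neg_distrib] at h3
  have h4 : ∑ i, ⟪gradP z i, p i - y i⟫ = ⟪gradP z, p - z⟫ - ⟪gradP z, y - z⟫ := by
    rw [← inner_sub_right, sub_sub_sub_cancel_right, PiLp.inner_apply]
    rfl
  linarith

/-- summed inequality for the asynchronous blockwise proximal gradient
iteration, with `Ψ = P + Σᵢ qᵢ` and minimizer `λ*` of `Ψ`: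
`Σ_{k=0}^{K}(Ψ(λ(k+1)) − Ψ(λ*)) ≤ Σ_{k=0}^{K} Σᵢ (h(D+1)²/2 − 1/(2cᵢ))‖λᵢ(k+1) − λᵢ(k)‖²
  + Σᵢ (1/(2cᵢ))‖λᵢ(0) − λ*ᵢ‖²`. -/
theorem stmt11 {N : ℕ} (dims : Fin N → ℕ) (h : ℝ) (hh : 0 < h)
    (P : Blk dims → ℝ) (gradP : Blk dims → Blk dims)
    (hPconv : ConvexOn ℝ Set.univ P)
    (hPdiff : ∀ x, HasGradientAt P (gradP x) x)
    (hLip : ∀ u v : Blk dims, ‖gradP u - gradP v‖ ≤ h * ‖u - v‖)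
    (q : ∀ i : Fin N, EuclideanSpace ℝ (Fin (dims i)) → EReal)
    (hqproper : ∀ i, ProperE (q i)) (hqlsc : ∀ i, LowerSemicontinuous (q i))
    (hqconv : ∀ i, ERealConvexOn (q i))
    (c : Fin N → ℝ) (hc : ∀ i, 0 < c i)
    (D : ℕ) (τ : ℕ → ℕ) (hτ : ∀ k : ℕ, τ k ≤ k ∧ k - τ k ≤ D)
    (lam : ℕ → Blk dims)
    (hiter : ∀ (k : ℕ) (i : Fin N), ∀ v : EuclideanSpace ℝ (Fin (dims i)),
      q i (lam (k + 1) i) +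
          ((1 / (2 * c i) *
            ‖lam (k + 1) i - (lam k i - c i • gradP (lam (τ k)) i)‖ ^ 2 : ℝ) : EReal)
        ≤ q i v +
          ((1 / (2 * c i) * ‖v - (lam k i - c i • gradP (lam (τ k)) i)‖ ^ 2 : ℝ) : EReal))
    (lamstar : Blk dims)
    (hmin : ∀ x : Blk dims,
      (P lamstar : EReal) + ∑ i : Fin N, q i (lamstar i)
        ≤ (P x : EReal) + ∑ i : Fin N, q i (x i)) :
    ∀ K : ℕ,
      (∑ k ∈ Finset.range (K + 1),
        (((P (lam (k + 1)) : EReal) + ∑ i : Fin N, q i (lam (k + 1) i)) -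
          ((P lamstar : EReal) + ∑ i : Fin N, q i (lamstar i))))
        ≤ ((∑ k ∈ Finset.range (K + 1), ∑ i : Fin N,
              (h * ((D : ℝ) + 1) ^ 2 / 2 - 1 / (2 * c i)) * ‖lam (k + 1) i - lam k i‖ ^ 2
            + ∑ i : Fin N, 1 / (2 * c i) * ‖lam 0 i - lamstar i‖ ^ 2 : ℝ) : EReal) := by
  intro K
  have hfin_lam : ∀ k i, ∃ r : ℝ, q i (lam (k + 1) i) = r := by
    intro k i
    obtain ⟨v, hv⟩ := (hqproper i).2
    refine ⟨_, (EReal.coe_toReal (fun htop => ?_) ((hqproper i).1 _)).symm⟩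
    have := hiter k i v
    rw [htop, EReal.top_add_coe, top_le_iff] at this
    exact EReal.add_ne_top hv (EReal.coe_ne_top _) this
  have hfin_star : ∀ i, ∃ s : ℝ, q i (lamstar i) = s := by
    have hbot : ∀ i ∈ univ, q i (lamstar i) ≠ ⊥ := fun i _ => (hqproper i).1 _
    have hsum : ∑ i, q i (lamstar i) ≠ ⊤ := by
      intro htop
      choose r hr using fun i => hfin_lam 0 i
      have := hmin (lam 1)
      rw [htop, EReal.coe_add_top, top_le_iff] at this
      simp only [zero_add] at hr
      simp only [hr, ← EReal.coe_sum_real, ← EReal.coe_add] at this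
      exact EReal.coe_ne_top _ this
    exact fun i => ⟨_, (EReal.coe_toReal
      (EReal.ne_top_of_sum_ne_top hbot hsum (mem_univ i)) ((hqproper i).1 _)).symm⟩
  choose r hr using hfin_lam
  choose s hs using hfin_star
  simp only [hr, hs, ← EReal.coe_sum_real, ← EReal.coe_add, ← EReal.coe_sub]
  rw [EReal.coe_le_coe_iff]
  have hstep (k : ℕ) := delayed_step_le hPconv hPdiff hLip (x := lam k) (p := lam (k + 1))
    (y := lamstar) (z := lam (τ k)) (r := r k) (s := s) (c := c) fun i =>
      prox_step_sub_le (hqconv i) (hc i) (hr k i) (hs i) (hiter k i)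
  have hdelay := mul_le_mul_of_nonneg_left (sum_norm_delay_sq_le lam hτ (K + 1)) (half_pos hh).le
  have htel : ∑ k ∈ range (K + 1), ∑ i, 1 / (2 * c i) *
      (‖lam k i - lamstar i‖ ^ 2 - ‖lam (k + 1) i - lamstar i‖ ^ 2)
      ≤ ∑ i, 1 / (2 * c i) * ‖lam 0 i - lamstar i‖ ^ 2 := by
    rw [Finset.sum_comm]
    refine Finset.sum_le_sum fun i _ => ?_
    rw [← Finset.mul_sum, Finset.sum_range_sub' (fun k => ‖lam k i - lamstar i‖ ^ 2)]
    have := hc i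
    gcongr
    exact sub_le_self _ (by positivity)
  have hnorm (k : ℕ) : ‖lam (k + 1) - lam k‖ ^ 2 = ∑ i, ‖lam (k + 1) i - lam k i‖ ^ 2 :=
    PiLp.norm_sq_eq_of_L2 _ _
  calc _ ≤ ∑ k ∈ range (K + 1), (h / 2 * ‖lam (k + 1) - lam (τ k)‖ ^ 2
        + ∑ i, 1 / (2 * c i) * (‖lam k i - lamstar i‖ ^ 2 - ‖lam (k + 1) i - lam k i‖ ^ 2
          - ‖lam (k + 1) i - lamstar i‖ ^ 2)) := Finset.sum_le_sum fun k _ => hstep k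
    _ = h / 2 * ∑ k ∈ range (K + 1), ‖lam (k + 1) - lam (τ k)‖ ^ 2
        + (∑ k ∈ range (K + 1), ∑ i, 1 / (2 * c i) *
            (‖lam k i - lamstar i‖ ^ 2 - ‖lam (k + 1) i - lamstar i‖ ^ 2)
          - ∑ k ∈ range (K + 1), ∑ i, 1 / (2 * c i) * ‖lam (k + 1) i - lam k i‖ ^ 2) := by
      rw [Finset.sum_add_distrib, ← Finset.mul_sum]
      simp only [← Finset.sum_sub_distrib]
      congr! 3 with k _ i _
      ring
    _ ≤ h / 2 * (((D : ℝ) + 1) ^ 2 * ∑ k ∈ range (K + 1), ‖lam (k + 1) - lam k‖ ^ 2)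
        + (∑ i, 1 / (2 * c i) * ‖lam 0 i - lamstar i‖ ^ 2
          - ∑ k ∈ range (K + 1), ∑ i, 1 / (2 * c i) * ‖lam (k + 1) i - lam k i‖ ^ 2) := by
      gcongr
    _ = _ := by
      simp only [hnorm, sub_mul, Finset.sum_sub_distrib, ← Finset.mul_sum]
      ring
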